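/- (High entropy implies high epistemic uncertainty.) Let K ≥ 2, let δ ∈ [0, Real.log K], and let α ∈ [1/K, 1] satisfy H_max(α) = δ. Then for every probability vector p on K classes with H(p) ≥ δ, every coordinate satisfies p j ≤ α; consequently, for every class y* with p y* > 0, the epistemic uncertainty under zero aleatoric uncertainty satisfies -Real.log (p y*) ≥ -Real.log α. -/

import Mathlib

/-- A probability vector on `K` classes. -/
def IsProbVec {K : ℕ} (p : Fin K → ℝ) : Prop :=
  (∀ i, 0 ≤ p i) ∧ ∑ i, p i = 1

/-- Shannon entropy, with the convention `0 * log 0 = 0`. -/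
noncomputable def entropy {K : ℕ} (p : Fin K → ℝ) : ℝ :=
  ∑ i, -(p i * Real.log (p i))

/-- `H_max(α) = -(α log α) - ((1-α) log ((1-α)/(K-1)))`,
with the convention `0 * log 0 = 0`. -/
noncomputable def Hmax (K : ℕ) (α : ℝ) : ℝ :=
  -(α * Real.log α) - ((1 - α) * Real.log ((1 - α) / ((K : ℝ) - 1)))

lemma Hmax_eq_qary (K : ℕ) (hK : 2 ≤ K) (a : ℝ) : Hmax K a = Real.qaryEntropy K (1 - a) := by
  have hK' : (2 : ℝ) ≤ K := by exact_mod_cast hK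
  unfold Hmax Real.qaryEntropy
  rw [Real.binEntropy_one_sub, Real.binEntropy_eq_negMulLog_add_negMulLog_one_sub]
  unfold Real.negMulLog
  push_cast
  by_cases h : 1 - a = 0
  · rw [h]; simp
  · rw [Real.log_div h (by linarith)]; ring

lemma entropy_le_Hmax {K : ℕ} (hK : 2 ≤ K) (p : Fin K → ℝ) (hp : IsProbVec p) (j : Fin K) :
    entropy p ≤ Hmax K (p j) := by
  have hK' : (2 : ℝ) ≤ K := by exact_mod_cast hK
  have hpos : (0 : ℝ) < (K : ℝ) - 1 := by linarith
  have hcard : (((Finset.univ.erase j).card : ℕ) : ℝ) = (K : ℝ) - 1 := by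
    rw [Finset.card_erase_of_mem (Finset.mem_univ j), Finset.card_univ, Fintype.card_fin,
      Nat.cast_sub (by omega)]
    simp
  have hsum : ∑ i ∈ Finset.univ.erase j, p i = 1 - p j := by
    have := Finset.add_sum_erase Finset.univ p (Finset.mem_univ j)
    rw [hp.2] at this
    linarith
  have hJ := Real.concaveOn_negMulLog.le_map_sum (t := Finset.univ.erase j)
    (w := fun _ => ((K : ℝ) - 1)⁻¹) (p := p)
    (fun i _ => by positivity)
    (by rw [Finset.sum_const, nsmul_eq_mul, hcard]; exact mul_inv_cancel₀ hpos.ne')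
    (fun i _ => hp.1 i)
  simp only [smul_eq_mul] at hJ
  rw [← Finset.mul_sum, ← Finset.mul_sum, hsum] at hJ
  have h2 : ∑ i ∈ Finset.univ.erase j, Real.negMulLog (p i) ≤
      ((K : ℝ) - 1) * Real.negMulLog (((K : ℝ) - 1)⁻¹ * (1 - p j)) := by
    rwa [inv_mul_le_iff₀ hpos] at hJ
  have h3 : ((K : ℝ) - 1) * Real.negMulLog (((K : ℝ) - 1)⁻¹ * (1 - p j)) =
      -((1 - p j) * Real.log ((1 - p j) / ((K : ℝ) - 1))) := by
    unfold Real.negMulLog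
    rw [inv_mul_eq_div]
    field_simp
  have h4 : entropy p = Real.negMulLog (p j) +
      ∑ i ∈ Finset.univ.erase j, Real.negMulLog (p i) := by
    rw [Finset.add_sum_erase Finset.univ (fun i => Real.negMulLog (p i)) (Finset.mem_univ j)]
    simp [entropy, Real.negMulLog]
  have h5 : Real.negMulLog (p j) = -(p j * Real.log (p j)) := by simp [Real.negMulLog]
  unfold Hmax
  linarith

/-- High entropy implies high epistemic uncertainty: if `H(p) ≥ δ` then all
coordinates are at most `α_δ`, so `-log p(y*) ≥ -log α_δ`. -/
theorem high_entropy_high_EU {K : ℕ} (hK : 2 ≤ K)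
    (δ : ℝ) (hδ : δ ∈ Set.Icc (0 : ℝ) (Real.log K))
    (α : ℝ) (hα : α ∈ Set.Icc (1 / (K : ℝ)) 1) (hHα : Hmax K α = δ)
    (p : Fin K → ℝ) (hp : IsProbVec p) (hH : δ ≤ entropy p) :
    (∀ j, p j ≤ α) ∧
    ∀ ystar : Fin K, 0 < p ystar → -Real.log α ≤ -Real.log (p ystar) := by
  have key : ∀ j, p j ≤ α := by
    intro j
    by_contra hlt
    push Not at hlt
    have hle : p j ≤ 1 := by
      rw [← hp.2]
      exact Finset.single_le_sum (fun i _ => hp.1 i) (Finset.mem_univ j)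
    have h1 := entropy_le_Hmax hK p hp j
    have h2 := Real.qaryEntropy_strictMonoOn hK
      (show 1 - p j ∈ Set.Icc 0 (1 - 1 / (K : ℝ)) from
        ⟨by linarith, by linarith [hα.1]⟩)
      (show 1 - α ∈ Set.Icc 0 (1 - 1 / (K : ℝ)) from
        ⟨by linarith [hα.2], by linarith [hα.1]⟩) (by linarith)
    rw [← Hmax_eq_qary K hK, ← Hmax_eq_qary K hK] at h2
    linarith
  exact ⟨key, fun y hy => neg_le_neg (Real.log_le_log hy (key y))⟩
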